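/- arXiv:quant-ph/0109026 — 3 statements merged into one kernel-verified Lean document; each statement's English description precedes it below -/
import Mathlib

section
/- Let (λ_k)_{k∈ℕ} be nonnegative reals with ∑_{k=0}^∞ λ_k = 1, and for each k let ψ_k be a unit phase wave function. Let X ⊆ [0,2π) be a Borel set whose Lebesgue measure is strictly less than 2π. Then ∑_{k=0}^∞ λ_k · (2π)^{-1} ∫_X |ψ_k(θ)|² dθ < 1. -/
open MeasureTheory Real Set

open AddCircle in
theorem AddCircle.measure_ext_of_integral_fourier_eq {T : ℝ} [Fact (0 < T)]
    {μ ν : Measure (AddCircle T)} [IsFiniteMeasure μ] [IsFiniteMeasure ν]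
    (h : ∀ n : ℤ, ∫ t, fourier n t ∂μ = ∫ t, fourier n t ∂ν) : μ = ν := by
  have hInt (ρ : Measure (AddCircle T)) [IsFiniteMeasure ρ] (φ : C(AddCircle T, ℂ)) :
      Integrable φ ρ :=
    .of_bound φ.continuous.aestronglyMeasurable ‖φ‖ (.of_forall φ.norm_coe_le_norm)
  let L (ρ : Measure (AddCircle T)) [IsFiniteMeasure ρ] : C(AddCircle T, ℂ) →L[ℂ] ℂ :=
    LinearMap.mkContinuous
      { toFun := fun φ ↦ ∫ t, φ t ∂ρ
        map_add' := fun φ χ ↦ integral_add (hInt ρ φ) (hInt ρ χ)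
        map_smul' := fun c φ ↦ integral_smul c φ } (ρ.real univ)
      fun φ ↦ by
        rw [mul_comm]
        exact norm_integral_le_of_norm_le_const (.of_forall φ.norm_coe_le_norm)
  have hL : L μ = L ν :=
    ContinuousLinearMap.ext_on
      (Submodule.dense_iff_topologicalClosure_eq_top.2 span_fourier_closure_eq_top)
      (by rintro _ ⟨n, rfl⟩; exact h n)
  refine ext_of_forall_integral_eq_of_IsFiniteMeasure fun φ ↦ ?_
  have := DFunLike.congr_fun hL ⟨fun t ↦ (φ t : ℂ), by fun_prop⟩
  have h2 : ∫ t, (φ t : ℂ) ∂μ = ∫ t, (φ t : ℂ) ∂ν := this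
  rwa [integral_complex_ofReal, integral_complex_ofReal, Complex.ofReal_inj] at h2

open AddCircle in
theorem ae_eq_const_of_fourierCoeff_eq_zero {T : ℝ} [Fact (0 < T)] {w : AddCircle T → ℝ}
    (hw : Integrable w haarAddCircle) (hw0 : 0 ≤ w)
    (h : ∀ n ≠ 0, fourierCoeff (fun t ↦ (w t : ℂ)) n = 0) :
    w =ᵐ[haarAddCircle] fun _ ↦ ∫ t, w t ∂haarAddCircle := by
  set c : ℝ := ∫ t, w t ∂haarAddCircle with hc
  have hc0 : 0 ≤ c := integral_nonneg hw0
  have : IsFiniteMeasure (haarAddCircle.withDensity fun t ↦ ENNReal.ofReal (w t)) :=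
    isFiniteMeasure_withDensity_ofReal hw.2
  have : IsFiniteMeasure ((haarAddCircle (T := T)).withDensity fun _ ↦ ENNReal.ofReal c) :=
    isFiniteMeasure_withDensity_ofReal (integrable_const c).2
  have key : haarAddCircle.withDensity (fun t ↦ ENNReal.ofReal (w t)) =
      haarAddCircle.withDensity fun _ ↦ ENNReal.ofReal c := by
    refine AddCircle.measure_ext_of_integral_fourier_eq fun n ↦ ?_
    rw [integral_withDensity_eq_integral_toReal_smul₀ hw.1.aemeasurable.ennreal_ofReal (by simp),
      integral_withDensity_eq_integral_toReal_smul₀ (by fun_prop) (by simp)]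
    simp_rw [ENNReal.toReal_ofReal (hw0 _), ENNReal.toReal_ofReal hc0]
    rcases eq_or_ne n 0 with rfl | hn
    · simp only [fourier_zero, Complex.real_smul, mul_one, integral_complex_ofReal, integral_const]
      simp [hc]
    · have h1 := h (-n) (neg_ne_zero.2 hn)
      have h2 : ∫ t : AddCircle T, fourier n t ∂haarAddCircle = 0 := by
        have : inner ℂ (fourierLp (T := T) 2 0) (fourierLp 2 n) = 0 :=
          orthonormal_fourier.2 hn.symm
        rw [ContinuousMap.inner_toLp] at this
        simpa using this
      rw [integral_smul, h2, smul_zero, ← h1, fourierCoeff]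
      simp [mul_comm]
  have := (withDensity_eq_iff hw.1.aemeasurable.ennreal_ofReal (by fun_prop)
    hw.lintegral_lt_top.ne).1 key
  filter_upwards [this] with t ht
  exact (ENNReal.ofReal_eq_ofReal_iff (hw0 t) hc0).1 ht

open AddCircle in
theorem memLp_fourier_mul {T : ℝ} [Fact (0 < T)] (n : ℤ) {p : ENNReal} {g : AddCircle T → ℂ}
    (hg : MemLp g p haarAddCircle) : MemLp (fun t ↦ fourier n t * g t) p haarAddCircle :=
  hg.of_le ((fourier n).continuous.aestronglyMeasurable.mul hg.1)
    (.of_forall fun t ↦ by rw [norm_mul, fourier_apply, Circle.norm_coe, one_mul])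

open AddCircle in
/-- Multiplication of an `L²` function on the circle by the monomial `fourier n`. -/
noncomputable def fourierMulLp {T : ℝ} [Fact (0 < T)] (n : ℤ)
    (g : Lp ℂ 2 (haarAddCircle (T := T))) : Lp ℂ 2 (haarAddCircle (T := T)) :=
  (memLp_fourier_mul n (Lp.memLp g)).toLp

open AddCircle in
theorem coeFn_fourierMulLp {T : ℝ} [Fact (0 < T)] (n : ℤ)
    (g : Lp ℂ 2 (haarAddCircle (T := T))) :
    fourierMulLp n g =ᵐ[haarAddCircle] fun t ↦ fourier n t * g t :=
  MemLp.coeFn_toLp _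

open AddCircle in
theorem fourierMulLp_zero {T : ℝ} [Fact (0 < T)] (g : Lp ℂ 2 (haarAddCircle (T := T))) :
    fourierMulLp 0 g = g := by
  apply Lp.ext
  filter_upwards [coeFn_fourierMulLp 0 g] with t ht
  rw [ht, fourier_zero, one_mul]

open AddCircle in
theorem inner_fourierMulLp {T : ℝ} [Fact (0 < T)] (m n : ℤ)
    (g h : Lp ℂ 2 (haarAddCircle (T := T))) :
    inner ℂ (fourierMulLp m g) (fourierMulLp n h) = inner ℂ g (fourierMulLp (n - m) h) := by
  rw [L2.inner_def, L2.inner_def]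
  apply integral_congr_ae
  filter_upwards [coeFn_fourierMulLp m g, coeFn_fourierMulLp n h, coeFn_fourierMulLp (n - m) h]
    with t h1 h2 h3
  rw [h1, h2, h3, sub_eq_add_neg, fourier_add, fourier_neg]
  simp only [RCLike.inner_apply', map_mul]
  ring

open AddCircle in
theorem fourierCoeff_fourierMulLp {T : ℝ} [Fact (0 < T)] (n k : ℤ)
    (g : Lp ℂ 2 (haarAddCircle (T := T))) :
    fourierCoeff (fourierMulLp n g) k = fourierCoeff g (k - n) := by
  apply integral_congr_ae
  filter_upwards [coeFn_fourierMulLp n g] with t ht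
  rw [ht, smul_eq_mul, smul_eq_mul, ← mul_assoc, ← fourier_add]
  congr 3
  ring

open AddCircle in
theorem inner_fourierLp {T : ℝ} [Fact (0 < T)] (n : ℤ) (g : Lp ℂ 2 (haarAddCircle (T := T))) :
    inner ℂ (fourierLp 2 n) g = fourierCoeff g n := by
  rw [← fourierBasis_repr, fourierBasis.repr_apply_apply, coe_fourierBasis]

open AddCircle in
theorem fourierCoeff_normSq {T : ℝ} [Fact (0 < T)] (n : ℤ) (g : Lp ℂ 2 (haarAddCircle (T := T))) :
    fourierCoeff (fun t ↦ ((‖g t‖ ^ 2 : ℝ) : ℂ)) n = inner ℂ (fourierMulLp n g) g := by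
  rw [L2.inner_def]
  apply integral_congr_ae
  filter_upwards [coeFn_fourierMulLp n g] with t ht
  rw [ht, fourier_neg]
  simp only [RCLike.inner_apply', map_mul, smul_eq_mul, mul_assoc, Complex.conj_mul',
    Complex.ofReal_pow]

open AddCircle in
/-- If `|g|²` is orthogonal to every nonconstant monomial, then `|g|` is constant. -/
theorem ae_ne_zero_of_inner_fourierMulLp_eq_zero {T : ℝ} [Fact (0 < T)]
    {g : Lp ℂ 2 (haarAddCircle (T := T))} (hg : g ≠ 0)
    (h : ∀ n : ℤ, 0 < n → inner ℂ (fourierMulLp n g) g = 0) :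
    ∀ᵐ t ∂haarAddCircle, g t ≠ 0 := by
  have hInt : Integrable (fun t ↦ ‖g t‖ ^ 2) haarAddCircle := (Lp.memLp g).norm.integrable_sq
  have hconst := ae_eq_const_of_fourierCoeff_eq_zero hInt (fun t ↦ sq_nonneg _) fun n hn ↦ by
    rw [fourierCoeff_normSq]
    rcases lt_or_gt_of_ne hn with hn | hn
    · have := inner_fourierMulLp (-n) 0 g g
      rw [zero_sub, neg_neg, fourierMulLp_zero, h (-n) (by lia)] at this
      rw [← inner_conj_symm, ← this, map_zero]
    · exact h n hn
  have hpos : 0 < ∫ t, ‖g t‖ ^ 2 ∂haarAddCircle := by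
    refine (integral_nonneg fun t ↦ sq_nonneg _).lt_of_ne' fun h0 ↦ hg ?_
    rw [Lp.eq_zero_iff_ae_eq_zero]
    filter_upwards [hconst] with t ht
    simpa [h0] using ht
  filter_upwards [hconst] with t ht h0
  rw [h0] at ht
  simp only [norm_zero, ne_eq, OfNat.ofNat_ne_zero, not_false_eq_true, zero_pow] at ht
  linarith

open AddCircle in
/-- **F. and M. Riesz uniqueness theorem** in `L²`. -/
theorem ae_ne_zero_of_fourierCoeff_eq_zero_of_pos {T : ℝ} [Fact (0 < T)]
    {f : Lp ℂ 2 (haarAddCircle (T := T))} (hf : f ≠ 0)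
    (h : ∀ n : ℤ, 0 < n → fourierCoeff f n = 0) :
    ∀ᵐ t ∂haarAddCircle, f t ≠ 0 := by
  obtain ⟨m, hm, hmax⟩ : ∃ m, fourierCoeff f m ≠ 0 ∧ ∀ n, fourierCoeff f n ≠ 0 → n ≤ m := by
    refine Int.exists_greatest_of_bdd ⟨0, fun n hn ↦ ?_⟩ ?_
    · by_contra! hn'
      exact hn (h n hn')
    · by_contra! h0
      refine hf (fourierBasis.repr.map_eq_zero_iff.1 ?_)
      ext n
      rw [fourierBasis_repr, h0]
      rfl
  let V : Submodule ℂ (Lp ℂ 2 (haarAddCircle (T := T))) :=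
    (Submodule.span ℂ ((fun n ↦ fourierMulLp n f) '' Iio 0)).topologicalClosure
  have : CompleteSpace V := (Submodule.isClosed_topologicalClosure _).completeSpace_coe
  have hV {u v : Lp ℂ 2 (haarAddCircle (T := T))} (hv : v ∈ V)
      (hu : ∀ n < 0, inner ℂ u (fourierMulLp n f) = 0) : inner ℂ u v = 0 := by
    have : V ≤ (Submodule.span ℂ {u})ᗮ := by
      refine Submodule.topologicalClosure_minimal _ (Submodule.span_le.2 ?_)
        (Submodule.isClosed_orthogonal _)
      rintro _ ⟨n, hn, rfl⟩
      exact Submodule.mem_orthogonal_singleton_iff_inner_right.2 (hu n hn)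
    exact Submodule.mem_orthogonal_singleton_iff_inner_right.1 (this hv)
  set p := V.starProjection f
  have hp : p ∈ V := V.starProjection_apply_mem f
  set g := f - p
  have hg : g ∈ Vᗮ := V.sub_starProjection_mem_orthogonal f
  have hgn (n : ℤ) (hn : n < 0) : inner ℂ g (fourierMulLp n f) = 0 :=
    Submodule.inner_left_of_mem_orthogonal (K := V)
      (Submodule.le_topologicalClosure _ (Submodule.subset_span ⟨n, hn, rfl⟩)) hg
  have hinner {u : Lp ℂ 2 (haarAddCircle (T := T))}
      (hu : ∀ n ≤ 0, inner ℂ u (fourierMulLp n f) = 0) : inner ℂ u g = 0 := by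
    rw [inner_sub_right, hV hp fun n hn ↦ hu n hn.le, sub_zero, ← fourierMulLp_zero f]
    exact hu 0 le_rfl
  have hg0 : g ≠ 0 := by
    intro h0
    refine hm ?_
    rw [← inner_fourierLp, ← sub_add_cancel f p, inner_add_right]
    change inner ℂ _ g + _ = _
    rw [h0, inner_zero_right, zero_add]
    refine hV hp fun n hn ↦ ?_
    rw [inner_fourierLp, fourierCoeff_fourierMulLp]
    by_contra h1
    linarith [hmax _ h1]
  have hgne := ae_ne_zero_of_inner_fourierMulLp_eq_zero hg0 fun k hk ↦
    hinner fun n hn ↦ by rw [inner_fourierMulLp]; exact hgn _ (by linarith)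
  set E : Set (AddCircle T) := f ⁻¹' {0}
  have hE : MeasurableSet E := (Lp.stronglyMeasurable f).measurable (measurableSet_singleton 0)
  have hgE : MemLp (E.indicator g) 2 haarAddCircle := (Lp.memLp g).indicator hE
  have hEg : ∫ t, E.indicator (fun t ↦ ‖g t‖ ^ 2) t ∂haarAddCircle = 0 := by
    have h0 : inner ℂ hgE.toLp g = 0 := hinner fun n _ ↦ by
      rw [L2.inner_def]
      refine integral_eq_zero_of_ae ?_
      filter_upwards [hgE.coeFn_toLp, coeFn_fourierMulLp n f] with t h1 h2
      rw [h1, h2]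
      by_cases ht : t ∈ E
      · rw [show f t = 0 from ht]; simp
      · simp [ht]
    rw [L2.inner_def] at h0
    rw [← Complex.ofReal_inj, ← integral_complex_ofReal, Complex.ofReal_zero, ← h0]
    refine integral_congr_ae ?_
    filter_upwards [hgE.coeFn_toLp] with t h1
    rw [h1]
    by_cases ht : t ∈ E <;> simp [ht]
  rw [integral_eq_zero_iff_of_nonneg (fun t ↦ indicator_nonneg (fun _ _ ↦ sq_nonneg _) t)
    ((Lp.memLp g).norm.integrable_sq.indicator hE)] at hEg
  filter_upwards [hEg, hgne] with t h1 h2 h3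
  rw [indicator_of_mem (show t ∈ E from h3)] at h1
  simp [h2] at h1

open AddCircle in
/-- A nonzero square-integrable function on `(0, 2π]` whose Fourier series contains only the
monomials `exp (-i n θ)` with `n ≥ 0` vanishes almost nowhere. -/
theorem ae_ne_zero_of_hardy {ψ : ℝ → ℂ} (hψ : MemLp ψ 2 (volume.restrict (Ioc 0 (2 * π))))
    (hne : ¬ ψ =ᵐ[volume.restrict (Ioc 0 (2 * π))] 0)
    (hHardy : ∀ n : ℤ, n < 0 →
      ∫ θ in Ioc (0 : ℝ) (2 * π), ψ θ * Complex.exp (Complex.I * (n : ℂ) * (θ : ℂ)) = 0) :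
    ∀ᵐ θ ∂volume.restrict (Ioc 0 (2 * π)), ψ θ ≠ 0 := by
  have hT : Fact (0 < 2 * π) := ⟨by positivity⟩
  rw [← zero_add (2 * π)] at hψ
  have hF : MemLp (liftIoc (2 * π) 0 ψ) 2 haarAddCircle := hψ.memLp_liftIoc.haarAddCircle
  have transfer {P : ℂ → Prop} (hP : ∀ᵐ t ∂haarAddCircle, P ((hF.toLp : Lp ℂ 2 _) t)) :
      ∀ᵐ θ ∂volume.restrict (Ioc 0 (2 * π)), P (ψ θ) := by
    have h1 : ∀ᵐ t : AddCircle (2 * π), P (liftIoc (2 * π) 0 ψ t) := by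
      rw [volume_eq_smul_haarAddCircle]
      refine Measure.ae_smul_measure ?_ _
      filter_upwards [hP, hF.coeFn_toLp] with t h1 h2
      rwa [← h2]
    have h2 := (AddCircle.measurePreserving_mk (2 * π) 0).quasiMeasurePreserving.ae h1
    rw [zero_add] at h2
    filter_upwards [h2, ae_restrict_mem measurableSet_Ioc] with θ h3 hθ
    rwa [liftIoc_coe_apply (by rwa [zero_add])] at h3
  refine transfer (P := (· ≠ 0)) (ae_ne_zero_of_fourierCoeff_eq_zero_of_pos (fun h0 ↦ hne ?_) ?_)
  · exact transfer (P := (· = 0)) (Lp.eq_zero_iff_ae_eq_zero.1 h0)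
  · intro n hn
    rw [fourierCoeff_congr_ae hF.coeFn_toLp, fourierCoeff_eq_intervalIntegral _ _ 0, zero_add,
      intervalIntegral.integral_of_le hT.out.le, smul_eq_zero]
    right
    rw [← hHardy (-n) (by lia)]
    refine setIntegral_congr_fun measurableSet_Ioc fun θ hθ ↦ ?_
    rw [liftIoc_coe_apply (by rwa [zero_add]), fourier_coe_apply, smul_eq_mul, mul_comm]
    congr 2
    push_cast
    field_simp

/-- A nonzero square-integrable function satisfying the Hardy condition is not localized in any
set that is not of full measure. -/
theorem setIntegral_normSq_lt_of_hardy {ψ : ℝ → ℂ} (hmeas : Measurable ψ)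
    (hL2 : IntegrableOn (fun θ ↦ ‖ψ θ‖ ^ 2) (Ico 0 (2 * π)))
    (hHardy : ∀ n : ℤ, n < 0 →
      ∫ θ in Ico (0 : ℝ) (2 * π), ψ θ * Complex.exp (Complex.I * (n : ℂ) * (θ : ℂ)) = 0)
    (hne : ∫ θ in Ico (0 : ℝ) (2 * π), ‖ψ θ‖ ^ 2 ≠ 0)
    {X : Set ℝ} (hXm : MeasurableSet X) (hXsub : X ⊆ Ico 0 (2 * π))
    (hXlt : volume X < ENNReal.ofReal (2 * π)) :
    ∫ θ in X, ‖ψ θ‖ ^ 2 < ∫ θ in Ico (0 : ℝ) (2 * π), ‖ψ θ‖ ^ 2 := by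
  have hres : volume.restrict (Ioc 0 (2 * π)) = volume.restrict (Ico 0 (2 * π)) :=
    Measure.restrict_congr_set Ico_ae_eq_Ioc.symm
  have hae : ∀ᵐ θ ∂volume.restrict (Ico 0 (2 * π)), ψ θ ≠ 0 := by
    rw [← hres]
    refine ae_ne_zero_of_hardy ?_ (fun h0 ↦ hne ?_) (by rwa [hres])
    · rw [hres]
      exact (memLp_two_iff_integrable_sq_norm hmeas.aestronglyMeasurable).2 hL2
    · rw [← hres]
      refine integral_eq_zero_of_ae ?_
      filter_upwards [h0] with θ hθ
      simp [hθ]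
  have hdiff : 0 < ∫ θ in Ico (0 : ℝ) (2 * π) \ X, ‖ψ θ‖ ^ 2 := by
    rw [setIntegral_pos_iff_support_of_nonneg_ae (.of_forall fun θ ↦ sq_nonneg _)
      (hL2.mono_set sdiff_subset)]
    have hvol : 0 < volume (Ico (0 : ℝ) (2 * π) \ X) := by
      rw [measure_sdiff hXsub hXm.nullMeasurableSet hXlt.ne_top, Real.volume_Ico, sub_zero]
      exact tsub_pos_of_lt hXlt
    refine hvol.trans_eq (measure_congr ?_)
    filter_upwards [(ae_restrict_iff' measurableSet_Ico).1 hae] with θ hθ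
    refine propext ⟨fun h ↦ ⟨?_, h⟩, fun h ↦ h.2⟩
    simpa using hθ h.1
  rw [setIntegral_sdiff hXm hL2 hXsub] at hdiff
  linarith

/-- **Nonlocalizability of covariant phase observables (Theorem 1), via the
decomposition into a convex combination of canonical phase densities.**
Let `(λ_k)` be nonnegative reals summing to `1`, and for each `k` let `ψ_k` be a
unit phase wave function (square-integrable on `[0,2π)`, vanishing negative
Fourier coefficients, normalized). If `X ⊆ [0,2π)` is a Borel set of Lebesgue
measure strictly less than `2π`, then `∑_k λ_k (2π)⁻¹ ∫_X |ψ_k(θ)|² dθ < 1`. -/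
theorem phase_nonlocalizable_mixture
    (lam : ℕ → ℝ) (hlam : ∀ k, 0 ≤ lam k) (hlamsum : HasSum lam 1)
    (ψ : ℕ → ℝ → ℂ) (hmeas : ∀ k, Measurable (ψ k))
    (hL2 : ∀ k, IntegrableOn (fun θ => ‖ψ k θ‖ ^ 2) (Ico 0 (2 * π)))
    (hHardy : ∀ k, ∀ n : ℤ, n < 0 →
      ∫ θ in Ico (0 : ℝ) (2 * π), ψ k θ * Complex.exp (Complex.I * (n : ℂ) * (θ : ℂ)) = 0)
    (hUnit : ∀ k, (1 / (2 * π)) * ∫ θ in Ico (0 : ℝ) (2 * π), ‖ψ k θ‖ ^ 2 = 1)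
    (X : Set ℝ) (hXm : MeasurableSet X) (hXsub : X ⊆ Ico 0 (2 * π))
    (hXlt : volume X < ENNReal.ofReal (2 * π)) :
    ∃ S : ℝ, HasSum (fun k => lam k * ((1 / (2 * π)) * ∫ θ in X, ‖ψ k θ‖ ^ 2)) S ∧ S < 1 := by
  have hpi : 0 < 1 / (2 * π) := by positivity
  have hlt (k : ℕ) : (1 / (2 * π)) * ∫ θ in X, ‖ψ k θ‖ ^ 2 < 1 := by
    refine lt_of_lt_of_eq ?_ (hUnit k)
    refine mul_lt_mul_of_pos_left (setIntegral_normSq_lt_of_hardy (hmeas k) (hL2 k) (hHardy k)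
      (fun h0 ↦ ?_) hXm hXsub hXlt) hpi
    simpa [h0] using hUnit k
  have hle (k : ℕ) : lam k * ((1 / (2 * π)) * ∫ θ in X, ‖ψ k θ‖ ^ 2) ≤ lam k :=
    mul_le_of_le_one_right (hlam k) (hlt k).le
  have hsum : Summable fun k ↦ lam k * ((1 / (2 * π)) * ∫ θ in X, ‖ψ k θ‖ ^ 2) :=
    hlamsum.summable.of_nonneg_of_le (fun k ↦ mul_nonneg (hlam k)
      (mul_nonneg hpi.le (integral_nonneg fun θ ↦ sq_nonneg _))) hle
  obtain ⟨k, hk⟩ : ∃ k, 0 < lam k := by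
    by_contra! h
    have h0 : lam = 0 := funext fun k ↦ (h k).antisymm (hlam k)
    exact zero_ne_one (hasSum_zero.unique (h0 ▸ hlamsum))
  exact ⟨_, hsum.hasSum, hasSum_lt hle (mul_lt_of_lt_one_right hk (hlt k)) hsum.hasSum hlamsum⟩
end

section
/- Let ψ be a unit phase wave function and let X ⊆ [0,2π) be a Borel set whose Lebesgue measure is strictly less than 2π. Then (2π)^{-1} ∫_X |ψ(θ)|² dθ < 1. -/
open MeasureTheory Real Set

/-- The character `θ ↦ exp (i n θ)`. -/
noncomputable def expMode (n : ℤ) (θ : ℝ) : ℂ := Complex.exp (Complex.I * (n : ℂ) * (θ : ℂ))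

@[fun_prop]
lemma continuous_expMode (n : ℤ) : Continuous (expMode n) := by
  unfold expMode
  fun_prop

lemma norm_expMode (n : ℤ) (θ : ℝ) : ‖expMode n θ‖ = 1 := by
  have : Complex.I * (n : ℂ) * (θ : ℂ) = ((n * θ : ℝ) : ℂ) * Complex.I := by
    push_cast
    ring
  rw [expMode, this, Complex.norm_exp_ofReal_mul_I]

@[simp]
lemma expMode_zero (θ : ℝ) : expMode 0 θ = 1 := by simp [expMode]

lemma expMode_add (m n : ℤ) (θ : ℝ) : expMode (m + n) θ = expMode m θ * expMode n θ := by
  simp only [expMode, ← Complex.exp_add]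
  congr 1
  push_cast
  ring

lemma conj_expMode (n : ℤ) (θ : ℝ) :
    (starRingEnd ℂ) (expMode n θ) = expMode (-n) θ := by
  simp [expMode, ← Complex.exp_conj]

/-- Lebesgue measure on one period. -/
noncomputable abbrev periodMeasure : Measure ℝ := volume.restrict (Ico 0 (2 * π))

lemma integral_expMode_of_ne_zero {n : ℤ} (hn : n ≠ 0) :
    ∫ θ, expMode n θ ∂periodMeasure = 0 := by
  have hc : Complex.I * (n : ℂ) ≠ 0 := by simp [hn]
  rw [integral_Ico_eq_integral_Ioc, ← intervalIntegral.integral_of_le (by positivity)]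
  simp only [expMode]
  rw [integral_exp_mul_complex hc]
  have : Complex.I * (n : ℂ) * ((2 * π : ℝ) : ℂ) = n * (2 * π * Complex.I) := by
    push_cast
    ring
  rw [this, Complex.exp_int_mul_two_pi_mul_I]
  simp

lemma integrable_expMode_mul {μ : Measure ℝ} {h : ℝ → ℂ} (hh : Integrable h μ) (n : ℤ) :
    Integrable (fun θ => expMode n θ * h θ) μ :=
  hh.bdd_mul (c := 1) (continuous_expMode n).aestronglyMeasurable
    (.of_forall fun θ => (norm_expMode n θ).le)

/-- If all Fourier coefficients of `h` vanish, `h` integrates to zero against every continuous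
function on the circle. -/
lemma integral_continuousMap_mul_eq_zero {h : ℝ → ℂ} (hh : Integrable h periodMeasure)
    (h0 : ∀ n : ℤ, ∫ θ, expMode n θ * h θ ∂periodMeasure = 0)
    (φ : C(AddCircle (2 * π), ℂ)) :
    ∫ θ, φ (θ : AddCircle (2 * π)) * h θ ∂periodMeasure = 0 := by
  have : Fact (0 < 2 * π) := ⟨by positivity⟩
  have hcont (φ : C(AddCircle (2 * π), ℂ)) :
      Continuous fun θ : ℝ => φ (θ : AddCircle (2 * π)) :=
    φ.continuous.comp (AddCircle.continuous_mk' _)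
  have hint (φ : C(AddCircle (2 * π), ℂ)) :
      Integrable (fun θ : ℝ => φ (θ : AddCircle (2 * π)) * h θ) periodMeasure :=
    hh.bdd_mul (hcont φ).aestronglyMeasurable (.of_forall fun θ => φ.norm_coe_le_norm _)
  let L : C(AddCircle (2 * π), ℂ) →L[ℂ] ℂ := LinearMap.mkContinuous
    { toFun := fun φ => ∫ θ, φ (θ : AddCircle (2 * π)) * h θ ∂periodMeasure
      map_add' := fun φ χ => by
        simp only [ContinuousMap.add_apply, add_mul]
        exact integral_add (hint φ) (hint χ)
      map_smul' := fun c φ => by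
        simp only [ContinuousMap.smul_apply, smul_eq_mul, mul_assoc, RingHom.id_apply]
        exact integral_const_mul _ _ }
    (∫ θ, ‖h θ‖ ∂periodMeasure) fun φ => by
      refine (norm_integral_le_of_norm_le (hh.norm.const_mul ‖φ‖)
        (.of_forall fun θ => ?_)).trans_eq ?_
      · rw [norm_mul]
        gcongr
        exact φ.norm_coe_le_norm _
      · rw [integral_const_mul, mul_comm]
  have hspan : Submodule.span ℂ (range (@fourier (2 * π))) ≤ L.ker := by
    rw [Submodule.span_le]
    rintro _ ⟨n, rfl⟩
    change ∫ θ, fourier n (θ : AddCircle (2 * π)) * h θ ∂periodMeasure = 0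
    rw [← h0 n]
    congr 1 with θ
    rw [fourier_coe_apply, expMode]
    congr 2
    have : (π : ℂ) ≠ 0 := by exact_mod_cast pi_ne_zero
    push_cast
    field_simp
  have htop := Submodule.topologicalClosure_minimal _ hspan L.isClosed_ker
  rw [span_fourier_closure_eq_top] at htop
  exact htop (Submodule.mem_top (x := φ))

/-- Uniqueness of Fourier coefficients for integrable functions on a period. -/
lemma ae_eq_zero_of_forall_integral_expMode_mul_eq_zero {h : ℝ → ℂ}
    (hh : Integrable h periodMeasure)
    (h0 : ∀ n : ℤ, ∫ θ, expMode n θ * h θ ∂periodMeasure = 0) :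
    h =ᵐ[periodMeasure] 0 := by
  have : Fact (0 < 2 * π) := ⟨by positivity⟩
  have hae : ∀ᵐ θ, θ ∈ Ioo 0 (2 * π) → h θ = 0 := by
    refine isOpen_Ioo.ae_eq_zero_of_integral_contDiff_smul_eq_zero
      (IntegrableOn.locallyIntegrableOn (hh.mono_measure
        (Measure.restrict_mono Ioo_subset_Ico_self le_rfl))) fun g hg _ hgs => ?_
    have hg0 (θ : ℝ) (hθ : θ ∉ Ioo 0 (2 * π)) : g θ = 0 := by
      by_contra hne
      exact hθ (hgs (subset_tsupport g hne))
    have hcont : Continuous (AddCircle.liftIco (2 * π) 0 fun θ => (g θ : ℂ)) := by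
      refine AddCircle.liftIco_continuous ?_ (by have := hg.continuous; fun_prop)
      rw [hg0 0 (by simp), hg0 (0 + 2 * π) (by simp)]
    have hzero := integral_continuousMap_mul_eq_zero hh h0 ⟨_, hcont⟩
    rw [← setIntegral_eq_integral_of_forall_compl_eq_zero (s := Ico 0 (2 * π)), ← hzero]
    · refine setIntegral_congr_fun measurableSet_Ico fun θ hθ => ?_
      simp only [ContinuousMap.coe_mk, AddCircle.liftIco_zero_coe_apply hθ, Complex.real_smul]
    · intro θ hθ
      rw [hg0 θ fun hθ' => hθ (Ioo_subset_Ico_self hθ'), zero_smul]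
  rw [periodMeasure, Measure.restrict_congr_set Ioo_ae_eq_Ico.symm]
  exact (ae_restrict_iff' measurableSet_Ioo).2 hae

/-- A square-integrable function with vanishing Fourier coefficients of negative index which is
zero on a set of positive measure has mean zero. -/
lemma integral_eq_zero_of_hardy_of_ae_eq_zero {ψ : ℝ → ℂ} (hψ : MemLp ψ 2 periodMeasure)
    (hHardy : ∀ n : ℤ, n < 0 → ∫ θ, expMode n θ * ψ θ ∂periodMeasure = 0)
    {E : Set ℝ} (hE : MeasurableSet E) (hEpos : periodMeasure E ≠ 0)
    (hψE : ∀ᵐ θ ∂periodMeasure, θ ∈ E → ψ θ = 0) :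
    ∫ θ, ψ θ ∂periodMeasure = 0 := by
  have hmode {u : ℝ → ℂ} (hu : MemLp u 2 periodMeasure) (n : ℤ) :
      MemLp (fun θ => expMode n θ * u θ) 2 periodMeasure :=
    hu.of_le ((continuous_expMode n).aestronglyMeasurable.mul hu.1)
      (.of_forall fun θ => by simp [norm_expMode])
  let F (k : ℕ) : Lp ℂ 2 periodMeasure := (hmode hψ (-(k : ℤ))).toLp _
  have hF (k : ℕ) : F k =ᵐ[periodMeasure] fun θ => expMode (-(k : ℤ)) θ * ψ θ :=
    MemLp.coeFn_toLp _
  let W := (Submodule.span ℂ (range fun k : ℕ => F (k + 1))).topologicalClosure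
  have hFW (k : ℕ) : F (k + 1) ∈ W :=
    Submodule.le_topologicalClosure _ (Submodule.subset_span ⟨k, rfl⟩)
  have horth (w : Lp ℂ 2 periodMeasure) (hw : ∀ k : ℕ, inner ℂ w (F (k + 1)) = 0)
      {p : Lp ℂ 2 periodMeasure} (hp : p ∈ W) : inner ℂ w p = 0 := by
    have hle : W ≤ (innerSL ℂ w).ker := by
      refine Submodule.topologicalClosure_minimal _ ?_ (innerSL ℂ w).isClosed_ker
      rw [Submodule.span_le]
      rintro _ ⟨k, rfl⟩
      exact hw k
    exact hle hp
  have : CompleteSpace W := (Submodule.isClosed_topologicalClosure _).completeSpace_coe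
  let p := W.starProjection (F 0)
  let g := F 0 - p
  have hpW : p ∈ W := W.starProjection_apply_mem _
  have hgF (k : ℕ) : inner ℂ g (F (k + 1)) = 0 :=
    W.starProjection_inner_eq_zero _ _ (hFW k)
  have hg2 : MemLp g 2 periodMeasure := Lp.memLp g
  have hginner (w : Lp ℂ 2 periodMeasure) (hw : ∀ k : ℕ, inner ℂ w (F (k + 1)) = 0) :
      inner ℂ w g = inner ℂ w (F 0) := by
    rw [inner_sub_right, horth w hw hpW, sub_zero]
  have hinner {u : ℝ → ℂ} (hu : MemLp u 2 periodMeasure) (v : Lp ℂ 2 periodMeasure) :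
      inner ℂ (hu.toLp u) v = ∫ θ, v θ * (starRingEnd ℂ) (u θ) ∂periodMeasure := by
    rw [L2.inner_def]
    refine integral_congr_ae ?_
    filter_upwards [hu.coeFn_toLp] with θ hθ
    rw [hθ]
    rfl
  have hmean : ∫ θ, g θ ∂periodMeasure = ∫ θ, ψ θ ∂periodMeasure := by
    have h1 : MemLp (fun _ : ℝ => (1 : ℂ)) 2 periodMeasure := memLp_const _
    have h1F (k : ℕ) : inner ℂ (h1.toLp _) (F k) =
        ∫ θ, expMode (-(k : ℤ)) θ * ψ θ ∂periodMeasure := by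
      rw [hinner]
      refine integral_congr_ae ?_
      filter_upwards [hF k] with θ hθ
      simp [hθ]
    have := hginner (h1.toLp _) fun k => by
      rw [h1F, hHardy _ (by omega)]
    rw [h1F, hinner] at this
    simpa using this
  have hgE : ∀ᵐ θ ∂periodMeasure, θ ∈ E → g θ = 0 := by
    have hEg : MemLp (E.indicator g) 2 periodMeasure := hg2.indicator hE
    have hEF (k : ℕ) : inner ℂ (hEg.toLp _) (F k) = 0 := by
      rw [hinner]
      refine integral_eq_zero_of_ae ?_
      filter_upwards [hF k, hψE] with θ hθ hθE
      by_cases hmem : θ ∈ E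
      · simp [hθ, hθE hmem]
      · simp [hmem]
    have hzero := hginner (hEg.toLp _) fun k => hEF _
    rw [hEF, hinner] at hzero
    have hre : ∫ θ, E.indicator (fun θ => ‖g θ‖ ^ 2) θ ∂periodMeasure = 0 := by
      rw [← Complex.ofReal_inj, ← integral_complex_ofReal, Complex.ofReal_zero, ← hzero]
      congr 1 with θ
      by_cases hmem : θ ∈ E
      · simp [hmem, Complex.mul_conj']
      · simp [hmem]
    rw [integral_eq_zero_iff_of_nonneg (fun θ => indicator_nonneg (fun _ _ => by positivity) θ)
      (((memLp_two_iff_integrable_sq_norm hg2.1).1 hg2).indicator hE)] at hre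
    filter_upwards [hre] with θ hθ hmem
    simpa [hmem] using hθ
  let q (θ : ℝ) : ℂ := ((‖g θ‖ ^ 2 : ℝ) : ℂ)
  have hqint : Integrable q periodMeasure :=
    ((memLp_two_iff_integrable_sq_norm hg2.1).1 hg2).ofReal
  have hqneg (m : ℕ) : ∫ θ, expMode (-((m + 1 : ℕ) : ℤ)) θ * q θ ∂periodMeasure = 0 := by
    have hmg := hmode hg2 ((m + 1 : ℕ) : ℤ)
    have hmF (k : ℕ) : inner ℂ (hmg.toLp _) (F k) = 0 := by
      rw [← hgF (k + m), hinner, L2.inner_def]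
      refine integral_congr_ae ?_
      filter_upwards [hF k, hF (k + m + 1)] with θ h1 h2
      have : -((k + m + 1 : ℕ) : ℤ) = -((m + 1 : ℕ) : ℤ) + -(k : ℤ) := by
        push_cast
        ring
      rw [h1, h2, this, expMode_add, map_mul, conj_expMode, RCLike.inner_apply]
      ring
    have hzero := hginner (hmg.toLp _) fun k => hmF _
    rw [hmF, hinner] at hzero
    rw [← hzero]
    congr 1 with θ
    simp only [q, map_mul, conj_expMode]
    rw [mul_left_comm, Complex.mul_conj']
    push_cast
    rfl
  have hqne (n : ℤ) (hn : n ≠ 0) : ∫ θ, expMode n θ * q θ ∂periodMeasure = 0 := by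
    obtain ⟨m, hm⟩ := Nat.exists_eq_succ_of_ne_zero (Int.natAbs_ne_zero.2 hn)
    obtain h | h : n = -((m + 1 : ℕ) : ℤ) ∨ -n = -((m + 1 : ℕ) : ℤ) := by omega
    · rw [h, hqneg]
    · have := congrArg (starRingEnd ℂ) (hqneg m)
      rw [← h, ← integral_conj, map_zero] at this
      simpa [q, conj_expMode] using this
  have hvol : (periodMeasure.real univ : ℂ) ≠ 0 := by
    simp [periodMeasure, Measure.real, ENNReal.toReal_ofReal, pi_pos.le, pi_ne_zero]
  let c : ℂ := (∫ θ, q θ ∂periodMeasure) / periodMeasure.real univ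
  have hqc : (fun θ => q θ - c) =ᵐ[periodMeasure] 0 := by
    refine ae_eq_zero_of_forall_integral_expMode_mul_eq_zero
      (hqint.sub (integrable_const c)) fun n => ?_
    have hsub : ∫ θ, expMode n θ * (q θ - c) ∂periodMeasure =
        ∫ θ, expMode n θ * q θ ∂periodMeasure - (∫ θ, expMode n θ ∂periodMeasure) * c := by
      simp_rw [mul_sub]
      rw [integral_sub (integrable_expMode_mul hqint n)
        (integrable_expMode_mul (integrable_const c) n), integral_mul_const]
    rw [hsub]
    rcases eq_or_ne n 0 with rfl | hn
    · simp only [expMode_zero, one_mul, integral_const, Complex.real_smul, mul_one, c]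
      rw [mul_div_cancel₀ _ hvol, sub_self]
    · rw [hqne n hn, integral_expMode_of_ne_zero hn, zero_mul, sub_zero]
  have hc : c = 0 := by
    by_contra hc
    refine hEpos (measure_mono_null (fun θ hθ => ?_) (ae_iff.1 (hgE.and hqc)))
    rintro ⟨h1, h2⟩
    simp [q, h1 hθ, hc] at h2
  rw [← hmean]
  refine integral_eq_zero_of_ae ?_
  filter_upwards [hqc] with θ hθ
  simpa [hc, q] using hθ

/-- Uniqueness theorem of F. and M. Riesz for square-integrable Hardy functions: vanishing on a
set of positive measure forces vanishing almost everywhere. -/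
lemma ae_eq_zero_of_hardy_of_ae_eq_zero {ψ : ℝ → ℂ} (hψ : MemLp ψ 2 periodMeasure)
    (hHardy : ∀ n : ℤ, n < 0 → ∫ θ, expMode n θ * ψ θ ∂periodMeasure = 0)
    {E : Set ℝ} (hE : MeasurableSet E) (hEpos : periodMeasure E ≠ 0)
    (hψE : ∀ᵐ θ ∂periodMeasure, θ ∈ E → ψ θ = 0) :
    ψ =ᵐ[periodMeasure] 0 := by
  have hnat (n : ℕ) : ∫ θ, expMode n θ * ψ θ ∂periodMeasure = 0 := by
    induction n using Nat.strong_induction_on with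
    | _ n ih =>
      refine integral_eq_zero_of_hardy_of_ae_eq_zero (E := E)
        (hψ.of_le ((continuous_expMode n).aestronglyMeasurable.mul hψ.1)
          (.of_forall fun θ => by simp [norm_expMode])) (fun m hm => ?_) hE hEpos ?_
      · simp_rw [← mul_assoc, ← expMode_add]
        rcases lt_or_ge (m + n) 0 with h | h
        · exact hHardy _ h
        · have := ih (m + n).toNat (by omega)
          rwa [Int.toNat_of_nonneg h] at this
      · filter_upwards [hψE] with θ hθ hmem
        rw [hθ hmem, mul_zero]
  refine ae_eq_zero_of_forall_integral_expMode_mul_eq_zero (hψ.integrable one_le_two) fun n => ?_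
  rcases lt_or_ge n 0 with h | h
  · exact hHardy n h
  · have := hnat n.toNat
    rwa [Int.toNat_of_nonneg h] at this

/-- **Nonlocalizability of the canonical phase observable.**
If `ψ` is a unit phase wave function (a unit vector of the Hardy space, i.e. a
square-integrable function on `[0,2π)` whose Fourier coefficients with negative
index vanish and whose normalized `L²`-norm is one), and `X ⊆ [0,2π)` is a Borel
set of Lebesgue measure strictly less than `2π`, then
`(2π)⁻¹ ∫_X |ψ(θ)|² dθ < 1`. -/
theorem phase_nonlocalizable_canonical
    (ψ : ℝ → ℂ) (hmeas : Measurable ψ)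
    (hL2 : IntegrableOn (fun θ => ‖ψ θ‖ ^ 2) (Ico 0 (2 * π)))
    (hHardy : ∀ n : ℤ, n < 0 →
      ∫ θ in Ico (0 : ℝ) (2 * π), ψ θ * Complex.exp (Complex.I * (n : ℂ) * (θ : ℂ)) = 0)
    (hUnit : (1 / (2 * π)) * ∫ θ in Ico (0 : ℝ) (2 * π), ‖ψ θ‖ ^ 2 = 1)
    (X : Set ℝ) (hXm : MeasurableSet X) (hXsub : X ⊆ Ico 0 (2 * π))
    (hXlt : volume X < ENNReal.ofReal (2 * π)) :
    (1 / (2 * π)) * ∫ θ in X, ‖ψ θ‖ ^ 2 < 1 := by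
  have hψ : MemLp ψ 2 periodMeasure :=
    (memLp_two_iff_integrable_sq_norm hmeas.aestronglyMeasurable).2 hL2
  have hsplit := integral_inter_add_sdiff (s := Ico 0 (2 * π)) hXm hL2
  rw [inter_eq_self_of_subset_right hXsub] at hsplit
  have hdiff_nonneg : 0 ≤ ∫ θ in Ico 0 (2 * π) \ X, ‖ψ θ‖ ^ 2 :=
    integral_nonneg fun θ => by positivity
  by_contra! hle
  have hdiff : ∫ θ in Ico 0 (2 * π) \ X, ‖ψ θ‖ ^ 2 = 0 := by
    refine le_antisymm ?_ hdiff_nonneg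
    have := le_of_mul_le_mul_left (hUnit.trans_le hle) (by positivity)
    linarith
  have hψE : ∀ᵐ θ ∂periodMeasure, θ ∈ Xᶜ → ψ θ = 0 := by
    rw [integral_eq_zero_iff_of_nonneg (fun θ => by positivity)
      (hL2.mono_set sdiff_subset), Filter.EventuallyEq,
      ae_restrict_iff' (measurableSet_Ico.diff hXm)] at hdiff
    rw [ae_restrict_iff' measurableSet_Ico]
    filter_upwards [hdiff] with θ hθ h1 h2
    simpa using hθ ⟨h1, h2⟩
  have hEpos : periodMeasure Xᶜ ≠ 0 := by
    intro h0
    refine hXlt.not_ge ?_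
    calc ENNReal.ofReal (2 * π) = periodMeasure univ := by simp
      _ ≤ periodMeasure X + periodMeasure Xᶜ := by
        rw [← union_compl_self X]
        exact measure_union_le _ _
      _ ≤ volume X := by
        rw [h0, add_zero]
        exact Measure.restrict_apply_le _ _
  have hzero := ae_eq_zero_of_hardy_of_ae_eq_zero hψ
    (fun n hn => by
      simpa only [expMode, mul_comm (Complex.exp _)] using hHardy n hn) hXm.compl hEpos hψE
  have : ∫ θ in Ico (0 : ℝ) (2 * π), ‖ψ θ‖ ^ 2 = 0 := by
    refine integral_eq_zero_of_ae ?_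
    filter_upwards [hzero] with θ hθ
    simp [hθ]
  simp [this] at hUnit
end

section
/- Let z : ℕ × ℕ → ℂ satisfy ∑_{n=0}^∞ |z_{n,k}|² = 1 for every k ∈ ℕ, let a ∈ ℓ²(ℕ,ℂ) with ∑_k |a_k|² = 1, and for each n let ψ_n ∈ L²([0,2π),ℂ) be the function with Fourier expansion ψ_n(θ) = ∑_{k≥0} z_{n,k} a_k e^{-ikθ}. Let X ⊆ [0,2π) be a Borel set whose Lebesgue measure is strictly less than 2π. Then ∑_{n=0}^∞ (2π)^{-1} ∫_X |ψ_n(θ)|² dθ < 1. -/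
open MeasureTheory Real Set

section Circle

open AddCircle

variable {T : ℝ} [hT : Fact (0 < T)]

theorem inner_fourierLp_left (f : Lp ℂ 2 (haarAddCircle (T := T))) (j : ℤ) :
    inner ℂ (fourierLp 2 j) f = fourierCoeff f j := by
  rw [← fourierBasis_repr, HilbertBasis.repr_apply_apply, coe_fourierBasis]

theorem memLp_fourier_mul_s16 {f : AddCircle T → ℂ} (hf : MemLp f 2 haarAddCircle) (k : ℤ) :
    MemLp (fun x => fourier k x * f x) 2 haarAddCircle := by
  refine hf.of_le ((fourier k).continuous.aestronglyMeasurable.mul hf.1) (.of_forall fun x => ?_)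
  simp [fourier_apply, Circle.norm_coe]

theorem fourierCoeff_fourier_mul (f : AddCircle T → ℂ) (k j : ℤ) :
    fourierCoeff (fun x => fourier k x * f x) j = fourierCoeff f (j - k) := by
  unfold fourierCoeff
  congr 1 with x
  rw [smul_eq_mul, smul_eq_mul, ← mul_assoc, ← fourier_add]
  congr 3
  ring

/-- Finite measures on the circle are determined by their Fourier coefficients. -/
theorem AddCircle.measure_ext_of_integral_fourier {μ ν : Measure (AddCircle T)}
    [IsFiniteMeasure μ] [IsFiniteMeasure ν]
    (h : ∀ k : ℤ, ∫ x, fourier k x ∂μ = ∫ x, fourier k x ∂ν) : μ = ν := by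
  let A : StarSubalgebra ℂ (BoundedContinuousFunction (AddCircle T) ℂ) :=
    (fourierSubalgebra (T := T)).comap (BoundedContinuousFunction.toContinuousMapStarₐ ℂ)
  refine ext_of_forall_mem_subalgebra_integral_eq_of_polish (𝕜 := ℂ) (A := A) ?_ fun g hg => ?_
  · intro x y hxy
    obtain ⟨_, ⟨f, hf, rfl⟩, hne⟩ := fourierSubalgebra_separatesPoints hxy
    exact ⟨f, ⟨f, ⟨BoundedContinuousFunction.mkOfCompact f, hf, rfl⟩, rfl⟩, hne⟩
  · have hspan : (BoundedContinuousFunction.toContinuousMapStarₐ ℂ g) ∈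
        Submodule.span ℂ (range (fourier (T := T))) := by
      rw [← fourierSubalgebra_coe]; exact hg
    have key : ∀ f ∈ Submodule.span ℂ (range (fourier (T := T))),
        ∫ x, f x ∂μ = ∫ x, f x ∂ν := by
      intro f hf
      have hint (ρ : Measure (AddCircle T)) [IsFiniteMeasure ρ] (u : C(AddCircle T, ℂ)) :
          Integrable u ρ :=
        (BoundedContinuousFunction.mkOfCompact u).integrable ρ
      induction hf using Submodule.span_induction with
      | mem _ hx => obtain ⟨k, rfl⟩ := hx; exact h k
      | zero => simp
      | add u v _ _ hu hv =>
        simp only [ContinuousMap.add_apply]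
        rw [integral_add (hint μ u) (hint μ v), integral_add (hint ν u) (hint ν v), hu, hv]
      | smul c u _ hu =>
        simp only [ContinuousMap.smul_apply, integral_smul, hu]
    exact key _ hspan

/-- If all nonconstant Fourier coefficients of `|g|²` vanish, then `g` is zero almost everywhere as
soon as it vanishes on a set of positive measure. -/
theorem eq_zero_of_integral_fourier_mul_norm_sq (g : Lp ℂ 2 (haarAddCircle (T := T)))
    (hg : ∀ k : ℤ, k ≠ 0 → ∫ x, fourier k x * (‖g x‖ ^ 2 : ℝ) ∂haarAddCircle = 0)
    (hE : haarAddCircle {x | g x = 0} ≠ 0) : g = 0 := by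
  have hint : Integrable (fun x => ‖g x‖ ^ 2) haarAddCircle :=
    (Lp.memLp g).integrable_norm_pow (by norm_num)
  have hsm : StronglyMeasurable g := Lp.stronglyMeasurable g
  have hnn : Measurable (fun x => ‖g x‖₊ ^ 2) := (hsm.measurable.nnnorm).pow_const 2
  let c : NNReal := ⟨∫ x, ‖g x‖ ^ 2 ∂haarAddCircle, integral_nonneg fun _ => by positivity⟩
  let ν : Measure (AddCircle T) :=
    haarAddCircle.withDensity fun x => ((‖g x‖₊ ^ 2 : NNReal) : ENNReal)
  have : IsFiniteMeasure ν := by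
    refine isFiniteMeasure_withDensity ?_
    refine ne_of_lt (lt_of_le_of_lt (le_of_eq ?_) hint.2)
    refine lintegral_congr fun x => ?_
    simp [enorm_eq_nnnorm]
  have hν : ν = c • haarAddCircle := by
    refine AddCircle.measure_ext_of_integral_fourier fun k => ?_
    rw [integral_withDensity_eq_integral_smul hnn, integral_smul_nnreal_measure]
    have e : ∀ x, (‖g x‖₊ ^ 2 : NNReal) • fourier k x = fourier k x * (‖g x‖ ^ 2 : ℝ) := by
      intro x
      rw [NNReal.smul_def, Complex.real_smul, mul_comm]; simp
    simp_rw [e]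
    by_cases hk : k = 0
    · subst hk
      simp only [fourier_zero, one_mul, integral_complex_ofReal]
      rw [NNReal.smul_def, Complex.real_smul]
      simp only [c, probReal_univ, integral_const, one_smul, mul_one]
      rfl
    · rw [hg k hk]
      have := (orthonormal_iff_ite.1 (orthonormal_fourier (T := T))) 0 k
      rw [inner_fourierLp_left, if_neg (Ne.symm hk), fourierCoeff_toLp] at this
      simp only [fourierCoeff, neg_zero, fourier_zero, one_smul] at this
      rw [this, smul_zero]
  have hmE : MeasurableSet {x | g x = 0} := hsm.measurable (measurableSet_singleton 0)
  have h0 : ν {x | g x = 0} = 0 := by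
    rw [withDensity_apply _ hmE]
    refine (setLIntegral_congr_fun hmE (g := 0) fun x hx => ?_).trans (by simp)
    have hx : g x = 0 := hx
    simp [hx]
  have hc : ∫ x, ‖g x‖ ^ 2 ∂haarAddCircle = 0 := by
    rw [hν] at h0
    have : c = 0 := by simpa [hE] using h0
    exact congrArg NNReal.toReal this
  rw [integral_eq_zero_iff_of_nonneg (fun _ => by positivity) hint] at hc
  rw [Lp.eq_zero_iff_ae_eq_zero]
  filter_upwards [hc] with x hx
  simpa using hx

/-- An `L²` function on the circle with no Fourier modes of positive index which vanishes on a set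
of positive measure has zero mean. -/
theorem fourierCoeff_zero_eq_zero_of_vanishing (f : Lp ℂ 2 (haarAddCircle (T := T)))
    (hf : ∀ j : ℤ, 0 < j → fourierCoeff f j = 0) (hE : haarAddCircle {x | f x = 0} ≠ 0) :
    fourierCoeff f 0 = 0 := by
  set E : Set (AddCircle T) := {x | f x = 0} with hEdef
  have hmE : MeasurableSet E := (Lp.stronglyMeasurable f).measurable (measurableSet_singleton 0)
  -- `M` consists of the functions vanishing on `E` and with no modes of positive index.
  let S : Set (Lp ℂ 2 (haarAddCircle (T := T))) :=
    {h | ∃ j : ℤ, 0 < j ∧ h = fourierLp 2 j} ∪ {h | ∀ᵐ x ∂haarAddCircle, x ∉ E → h x = 0}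
  let M : Submodule ℂ (Lp ℂ 2 (haarAddCircle (T := T))) := (Submodule.span ℂ S)ᗮ
  have mem_M (h : Lp ℂ 2 (haarAddCircle (T := T))) : h ∈ M ↔
      (∀ j : ℤ, 0 < j → fourierCoeff h j = 0) ∧ ∀ᵐ x ∂haarAddCircle, x ∈ E → h x = 0 := by
    constructor
    · intro hM
      refine ⟨fun j hj => ?_, ?_⟩
      · rw [← inner_fourierLp_left]
        exact hM _ (Submodule.subset_span (Or.inl ⟨j, hj, rfl⟩))
      · have hmem : MemLp (E.indicator h) 2 haarAddCircle := (Lp.memLp h).indicator hmE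
        have hco := hmem.coeFn_toLp
        have h1 : inner ℂ hmem.toLp h = 0 := by
          refine hM _ (Submodule.subset_span (Or.inr ?_))
          filter_upwards [hco] with x hx hxE
          rw [hx, indicator_of_notMem hxE]
        have h2 : inner ℂ hmem.toLp hmem.toLp = inner ℂ hmem.toLp h := by
          rw [L2.inner_def, L2.inner_def]
          refine integral_congr_ae ?_
          filter_upwards [hco] with x hx
          rw [hx]
          by_cases hxE : x ∈ E <;> simp [hxE]
        rw [h1, inner_self_eq_zero, Lp.eq_zero_iff_ae_eq_zero] at h2
        filter_upwards [hco, h2] with x hx hx' hxE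
        rw [hx, indicator_of_mem hxE] at hx'
        exact hx'
    · rintro ⟨h1, h2⟩
      rw [Submodule.mem_orthogonal]
      intro u hu
      induction hu using Submodule.span_induction with
      | mem u hu =>
        rcases hu with ⟨j, hj, rfl⟩ | hu
        · rw [inner_fourierLp_left, h1 j hj]
        · rw [L2.inner_def]
          refine integral_eq_zero_of_ae ?_
          filter_upwards [h2, hu] with x hx hx'
          by_cases hxE : x ∈ E
          · simp [hx hxE]
          · simp [hx' hxE]
      | zero => simp
      | add u v _ _ hu hv => rw [inner_add_left, hu, hv, add_zero]
      | smul c u _ hu => rw [inner_smul_left, hu, mul_zero]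
  have hfM : f ∈ M := (mem_M f).2 ⟨hf, .of_forall fun x hx => hx⟩
  let g : Lp ℂ 2 (haarAddCircle (T := T)) := M.starProjection (fourierLp 2 0)
  have hgM : g ∈ M := Submodule.starProjection_apply_mem _ _
  have hinner (h : Lp ℂ 2 (haarAddCircle (T := T))) (hh : h ∈ M) :
      inner ℂ g h = fourierCoeff h 0 := by
    rw [← inner_fourierLp_left, ← sub_eq_zero, ← inner_sub_left, ← neg_eq_zero, ← inner_neg_left,
      neg_sub]
    exact Submodule.starProjection_inner_eq_zero _ _ hh
  obtain ⟨hg1, hg2⟩ := (mem_M g).1 hgM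
  have hneg (k : ℤ) (hk : k < 0) : ∫ x, fourier k x * (‖g x‖ ^ 2 : ℝ) ∂haarAddCircle = 0 := by
    have hmem := memLp_fourier_mul_s16 (Lp.memLp g) k
    have hcoef (j : ℤ) : fourierCoeff hmem.toLp j = fourierCoeff g (j - k) := by
      rw [fourierCoeff_congr_ae hmem.coeFn_toLp, fourierCoeff_fourier_mul]
    have hM : hmem.toLp ∈ M := by
      refine (mem_M _).2 ⟨fun j hj => (hcoef j).trans (hg1 _ (by omega)), ?_⟩
      filter_upwards [hmem.coeFn_toLp, hg2] with x hx hx' hxE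
      rw [hx, hx' hxE, mul_zero]
    have := hinner _ hM
    rw [hcoef, hg1 _ (by omega), L2.inner_def] at this
    rw [← this]
    refine integral_congr_ae ?_
    filter_upwards [hmem.coeFn_toLp] with x hx
    rw [hx, RCLike.inner_apply, mul_assoc, RCLike.mul_conj]
    simp
  have hg0 : g = 0 := by
    refine eq_zero_of_integral_fourier_mul_norm_sq g (fun k hk => ?_) fun h0 => hE ?_
    · rcases lt_or_gt_of_ne hk with hk | hk
      · exact hneg k hk
      · have := congrArg (starRingEnd ℂ) (hneg (-k) (by omega))
        rw [← integral_conj] at this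
        simpa [fourier_neg] using this
    · refine measure_mono_null_ae ?_ h0
      filter_upwards [hg2] with x hx hxE using hx hxE
  rw [← hinner f hfM, hg0, inner_zero_left]

/-- **Uniqueness theorem for the Hardy space `H²`**: an `L²` function on the circle with no Fourier
modes of positive index which vanishes on a set of positive measure is zero. -/
theorem eq_zero_of_fourierCoeff_pos_eq_zero_of_vanishing (f : Lp ℂ 2 (haarAddCircle (T := T)))
    (hf : ∀ j : ℤ, 0 < j → fourierCoeff f j = 0) (hE : haarAddCircle {x | f x = 0} ≠ 0) :
    f = 0 := by
  by_contra hne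
  have hex : ∃ j, fourierCoeff f j ≠ 0 := by
    by_contra! hall
    refine hne (fourierBasis.repr.injective ?_)
    ext j
    simp [fourierBasis_repr, hall]
  obtain ⟨m, hm, hmax⟩ := Int.exists_greatest_of_bdd
    ⟨0, fun j hj => not_lt.1 fun h => hj (hf j h)⟩ hex
  have hmem := memLp_fourier_mul_s16 (Lp.memLp f) (-m)
  have hcoef (j : ℤ) : fourierCoeff hmem.toLp j = fourierCoeff f (j + m) := by
    rw [fourierCoeff_congr_ae hmem.coeFn_toLp, fourierCoeff_fourier_mul, sub_neg_eq_add]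
  refine hm ?_
  have := fourierCoeff_zero_eq_zero_of_vanishing hmem.toLp (fun j hj => ?_) fun h0 => hE ?_
  · rwa [hcoef, zero_add] at this
  · rw [hcoef]
    by_contra h
    have := hmax _ h
    omega
  · refine measure_mono_null_ae ?_ h0
    filter_upwards [hmem.coeFn_toLp] with x hx hxE
    have hxE : f x = 0 := hxE
    exact hx.trans (by rw [hxE, mul_zero])

/-- The `H²` uniqueness theorem for functions on an interval of length `T`. -/
theorem ae_eq_zero_of_fourierCoeff_liftIoc_pos_eq_zero {a : ℝ} {φ : ℝ → ℂ}
    (hφ : MemLp φ 2 (volume.restrict (Ioc a (a + T))))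
    (hcoef : ∀ j : ℤ, 0 < j → fourierCoeff (liftIoc T a φ) j = 0)
    (hE : volume.restrict (Ioc a (a + T)) {θ : ℝ | φ θ = 0} ≠ 0) :
    φ =ᵐ[volume.restrict (Ioc a (a + T))] 0 := by
  have hmem := hφ.memLp_liftIoc.haarAddCircle
  have hmp := AddCircle.measurePreserving_mk T a
  have hac : (volume : Measure (AddCircle T)) ≪ haarAddCircle := by
    rw [volume_eq_smul_haarAddCircle]
    exact Measure.smul_absolutelyContinuous
  have hpull : ∀ᵐ θ : ℝ ∂volume.restrict (Ioc a (a + T)),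
      hmem.toLp (liftIoc T a φ) (θ : AddCircle T) = φ θ := by
    filter_upwards [hmp.quasiMeasurePreserving.ae (hac.ae_le hmem.coeFn_toLp),
      ae_restrict_mem measurableSet_Ioc] with θ hθ hmemθ
    rw [hθ, liftIoc_coe_apply hmemθ]
  have hzero : hmem.toLp (liftIoc T a φ) = 0 := by
    refine eq_zero_of_fourierCoeff_pos_eq_zero_of_vanishing _ (fun j hj => ?_) fun h0 => hE ?_
    · rw [fourierCoeff_congr_ae hmem.coeFn_toLp, hcoef j hj]
    · refine measure_mono_null_ae ?_ (hmp.quasiMeasurePreserving.preimage_null (hac h0))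
      filter_upwards [hpull] with θ hθ hθ0
      exact hθ.trans hθ0
  rw [Lp.eq_zero_iff_ae_eq_zero] at hzero
  filter_upwards [hpull, hmp.quasiMeasurePreserving.ae (hac.ae_le hzero)] with θ h1 h2
  rw [← h1, h2]
  rfl

end Circle

theorem fourierCoeffOn_two_pi (φ : ℝ → ℂ) (j : ℤ) :
    fourierCoeffOn two_pi_pos φ j = ((1 / (2 * π) : ℝ) : ℂ) *
      ∫ θ in Ico (0 : ℝ) (2 * π), φ θ * Complex.exp (Complex.I * ((-j : ℤ) : ℂ) * (θ : ℂ)) := by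
  rw [fourierCoeffOn_eq_integral, intervalIntegral.integral_of_le two_pi_pos.le,
    ← integral_Ico_eq_integral_Ioc, sub_zero, Complex.real_smul]
  congr 2 with θ
  rw [fourier_coe_apply, smul_eq_mul, mul_comm]
  congr 2
  have : (π : ℂ) ≠ 0 := Complex.ofReal_ne_zero.2 pi_ne_zero
  push_cast
  field_simp

/-- Strict loss of `L²` mass on a set of less than full measure, for a nonzero function with no
Fourier modes of positive index. -/
theorem setIntegral_norm_sq_lt_of_fourierCoeffOn_pos_eq_zero {φ : ℝ → ℂ} (hmeas : Measurable φ)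
    (hL2 : IntegrableOn (fun θ => ‖φ θ‖ ^ 2) (Ico 0 (2 * π)))
    (hcoef : ∀ j : ℤ, 0 < j → fourierCoeffOn two_pi_pos φ j = 0)
    (hne : ∫ θ in Ico (0 : ℝ) (2 * π), ‖φ θ‖ ^ 2 ≠ 0)
    {X : Set ℝ} (hXm : MeasurableSet X) (hXsub : X ⊆ Ico 0 (2 * π))
    (hXlt : volume X < ENNReal.ofReal (2 * π)) :
    ∫ θ in X, ‖φ θ‖ ^ 2 < ∫ θ in Ico (0 : ℝ) (2 * π), ‖φ θ‖ ^ 2 := by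
  have : Fact (0 < 2 * π) := ⟨two_pi_pos⟩
  have hnn : 0 ≤ fun θ => ‖φ θ‖ ^ 2 := fun θ => by positivity
  refine lt_of_le_of_ne (setIntegral_mono_set hL2 (.of_forall hnn) hXsub.eventuallyLE) fun heq =>
    hne ?_
  have hdiff : ∫ θ in Ico (0 : ℝ) (2 * π) \ X, ‖φ θ‖ ^ 2 = 0 := by
    rw [setIntegral_sdiff hXm hL2 hXsub, heq, sub_self]
  rw [integral_eq_zero_iff_of_nonneg hnn (hL2.mono_set sdiff_subset)] at hdiff
  have hpos : volume (Ico (0 : ℝ) (2 * π) \ X) ≠ 0 := by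
    rw [measure_sdiff hXsub hXm.nullMeasurableSet hXlt.ne_top, Real.volume_Ico, sub_zero]
    exact (tsub_pos_of_lt hXlt).ne'
  have hφ0 : φ =ᵐ[volume.restrict (Ioc 0 (0 + 2 * π))] 0 := by
    have hL2' : Integrable (fun θ => ‖φ θ‖ ^ 2) (volume.restrict (Ioc 0 (0 + 2 * π))) := by
      rw [zero_add, ← restrict_Ico_eq_restrict_Ioc]
      exact hL2
    refine ae_eq_zero_of_fourierCoeff_liftIoc_pos_eq_zero
      ((memLp_two_iff_integrable_sq_norm hmeas.aestronglyMeasurable).2 hL2') (fun j hj => ?_) ?_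
    · rw [fourierCoeff_liftIoc_eq, ← hcoef j hj]
      congr 1
      exact zero_add _
    · rw [zero_add, ← restrict_Ico_eq_restrict_Ioc]
      intro h0
      refine hpos ?_
      have hfull : ∀ᵐ θ ∂volume.restrict (Ico (0 : ℝ) (2 * π) \ X), φ θ ≠ 0 :=
        ae_restrict_of_ae_restrict_of_subset sdiff_subset (by simpa only [ae_iff, not_not] using h0)
      have hfalse : ∀ᵐ θ ∂volume.restrict (Ico (0 : ℝ) (2 * π) \ X), False := by
        filter_upwards [hfull, hdiff] with θ h1 h2
        exact h1 (by simpa using h2)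
      simpa [ae_iff] using hfalse
  rw [integral_Ico_eq_integral_Ioc]
  rw [zero_add] at hφ0
  refine integral_eq_zero_of_ae ?_
  filter_upwards [hφ0] with θ hθ
  simp [hθ]

/-- **Nonlocalizability of an arbitrary covariant phase observable (Theorem 1),
via its decomposition into diagonal contractions.**  Let `z : ℕ × ℕ → ℂ` satisfy
`∑_n |z_{n,k}|² = 1` for every `k`, let `a` be a unit `ℓ²`-sequence, and for each
`n` let `ψ_n ∈ L²([0,2π),ℂ)` be the function with Fourier expansion
`ψ_n(θ) = ∑_{k≥0} z_{n,k} a_k e^{-ikθ}`.  If `X ⊆ [0,2π)` is a Borel set of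
Lebesgue measure strictly less than `2π`, then
`∑_n (2π)⁻¹ ∫_X |ψ_n(θ)|² dθ < 1`. -/
theorem phase_nonlocalizable_general
    (z : ℕ → ℕ → ℂ) (hz : ∀ k : ℕ, HasSum (fun n => ‖z n k‖ ^ 2) 1)
    (a : ℕ → ℂ) (ha : HasSum (fun k => ‖a k‖ ^ 2) 1)
    (ψ : ℕ → ℝ → ℂ) (hmeas : ∀ n, Measurable (ψ n))
    (hL2 : ∀ n, IntegrableOn (fun θ => ‖ψ n θ‖ ^ 2) (Ico 0 (2 * π)))
    (hHardy : ∀ n : ℕ, ∀ j : ℤ, j < 0 →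
      ∫ θ in Ico (0 : ℝ) (2 * π), ψ n θ * Complex.exp (Complex.I * (j : ℂ) * (θ : ℂ)) = 0)
    (hcoeff : ∀ n k : ℕ,
      ((1 / (2 * π) : ℝ) : ℂ) *
        ∫ θ in Ico (0 : ℝ) (2 * π), ψ n θ * Complex.exp (Complex.I * (k : ℂ) * (θ : ℂ))
        = z n k * a k)
    (X : Set ℝ) (hXm : MeasurableSet X) (hXsub : X ⊆ Ico 0 (2 * π))
    (hXlt : volume X < ENNReal.ofReal (2 * π)) :
    ∃ S : ℝ, HasSum (fun n => (1 / (2 * π)) * ∫ θ in X, ‖ψ n θ‖ ^ 2) S ∧ S < 1 := by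
  have hcoefOn (n : ℕ) (j : ℤ) (hj : 0 < j) : fourierCoeffOn two_pi_pos (ψ n) j = 0 := by
    rw [fourierCoeffOn_two_pi, hHardy n (-j) (by omega), mul_zero]
  have hparseval (n : ℕ) : HasSum (fun k => ‖z n k‖ ^ 2 * ‖a k‖ ^ 2)
      ((1 / (2 * π)) * ∫ θ in Ico (0 : ℝ) (2 * π), ‖ψ n θ‖ ^ 2) := by
    have hmem : MemLp (ψ n) 2 (volume.restrict (Ioc 0 (2 * π))) := by
      rw [memLp_two_iff_integrable_sq_norm (hmeas n).aestronglyMeasurable,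
        ← restrict_Ico_eq_restrict_Ioc]
      exact hL2 n
    have h := hasSum_sq_fourierCoeffOn two_pi_pos hmem
    rw [intervalIntegral.integral_of_le two_pi_pos.le, ← integral_Ico_eq_integral_Ioc, sub_zero,
      smul_eq_mul, ← one_div] at h
    have hinj : Function.Injective fun k : ℕ => -(k : ℤ) := fun k l hkl => by simpa using hkl
    rw [← hinj.hasSum_iff fun j hj => ?_] at h
    · convert h using 2 with k
      rw [Function.comp_apply, fourierCoeffOn_two_pi, neg_neg, Int.cast_natCast, hcoeff, norm_mul,
        mul_pow]
    · have hj' : 0 < j := by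
        by_contra! hle
        exact hj ⟨(-j).toNat, by simp [hle]⟩
      rw [hcoefOn n j hj', norm_zero, zero_pow two_ne_zero]
  have htotal : HasSum
      (fun n => (1 / (2 * π)) * ∫ θ in Ico (0 : ℝ) (2 * π), ‖ψ n θ‖ ^ 2) 1 := by
    have hcol (k : ℕ) : HasSum (fun n => ‖z n k‖ ^ 2 * ‖a k‖ ^ 2) (‖a k‖ ^ 2) := by
      simpa using (hz k).mul_right (‖a k‖ ^ 2)
    have hsum : Summable fun p : ℕ × ℕ => ‖z p.2 p.1‖ ^ 2 * ‖a p.1‖ ^ 2 := by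
      rw [summable_prod_of_nonneg fun p => by positivity]
      refine ⟨fun k => (hcol k).summable, ?_⟩
      simpa only [(hcol _).tsum_eq] using ha.summable
    have h1 := hsum.hasSum.prod_fiberwise hcol
    have h2 := ((Equiv.prodComm ℕ ℕ).hasSum_iff.2 hsum.hasSum).prod_fiberwise hparseval
    rwa [h1.unique ha] at h2
  have hpi : 0 < 1 / (2 * π) := by positivity
  have hle (n : ℕ) : (1 / (2 * π)) * ∫ θ in X, ‖ψ n θ‖ ^ 2 ≤
      (1 / (2 * π)) * ∫ θ in Ico (0 : ℝ) (2 * π), ‖ψ n θ‖ ^ 2 :=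
    mul_le_mul_of_nonneg_left (setIntegral_mono_set (hL2 n)
      (.of_forall fun θ => by positivity) hXsub.eventuallyLE) hpi.le
  have hsummable : Summable fun n => (1 / (2 * π)) * ∫ θ in X, ‖ψ n θ‖ ^ 2 :=
    htotal.summable.of_nonneg_of_le
      (fun n => mul_nonneg hpi.le (integral_nonneg fun θ => by positivity)) hle
  obtain ⟨n, hn⟩ : ∃ n, ∫ θ in Ico (0 : ℝ) (2 * π), ‖ψ n θ‖ ^ 2 ≠ 0 := by
    by_contra! hall
    simp only [hall, mul_zero] at htotal
    exact zero_ne_one (hasSum_zero.unique htotal)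
  refine ⟨_, hsummable.hasSum, hasSum_lt (i := n) hle ?_ hsummable.hasSum htotal⟩
  exact mul_lt_mul_of_pos_left (setIntegral_norm_sq_lt_of_fourierCoeffOn_pos_eq_zero (hmeas n)
    (hL2 n) (hcoefOn n) hn hXm hXsub hXlt) hpi
end
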